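/- (Quantum sine-Gordon field equation at the level of K-functions, Theorem 4.1.) Let 0 < ν < 1, β > 0 and Z > 0. Define the normalized K-functions K_n^{(1)} := N_n^{(1)}·K̃_n^{(1)} with N_n^{(1)} = ((1/2)·√Z)^n·(πν/β)^{1−n}, and K_n^{±} := N_n^{±}·K̃_n^{±} with N_n^{±} = ±i·(sin(πν)/sin(πν/2))·(√Z·β/(2πν))^n. Then for every integer n ≥ 1 and every admissible θ ∈ ℂ^n: (Σ_{i=1}^n e^{θ_i})·(Σ_{i=1}^n e^{−θ_i})·K_n^{(1)}(θ) = (πν/(β·sin(πν)))·(1/(2i))·(K_n^{+}(θ) − K_n^{−}(θ)). -/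

import Mathlib

open Finset

/-- The K-function `K_n[p](θ)` from the paper (eq. (1.2)):
`K_n[p](θ) = Σ_{l ∈ {0,1}^n} (−1)^{l_1+…+l_n} Π_{i<j} (1 + (l_i − l_j)·i·sin(πν)/sinh(θ_i − θ_j)) · p(θ,l)`. -/
noncomputable def Kfun (ν : ℝ) {n : ℕ} (p : (Fin n → ℂ) → (Fin n → Fin 2) → ℂ)
    (θ : Fin n → ℂ) : ℂ :=
  ∑ l : Fin n → Fin 2,
    (-1 : ℂ) ^ (∑ i, (l i : ℕ)) *
    (∏ i : Fin n, ∏ j : Fin n,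
      if (i : ℕ) < (j : ℕ) then
        1 + (((l i : ℕ) : ℂ) - ((l j : ℕ) : ℂ)) * Complex.I *
          (Real.sin (Real.pi * ν) : ℂ) / Complex.sinh (θ i - θ j)
      else 1) *
    p θ l

/-- `θ` is admissible if `sinh(θ_i − θ_j) ≠ 0` for all `i < j`. -/
def Admissible {n : ℕ} (θ : Fin n → ℂ) : Prop :=
  ∀ i j : Fin n, i < j → Complex.sinh (θ i - θ j) ≠ 0

/-- p-function of the N-th power of the field: `p^{(N)}(θ,l) = (Σ_i (−1)^{l_i})^N`. -/
noncomputable def pN (N : ℕ) {n : ℕ} : (Fin n → ℂ) → (Fin n → Fin 2) → ℂ :=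
  fun _ l => (∑ i, (-1 : ℂ) ^ (l i : ℕ)) ^ N

/-- p-function of the special exponentials `e^{±iβφ}` (ε = ±1):
`p^{±}(θ,l) = (Σ_i e^{∓θ_i}) · (Σ_i e^{±(θ_i − (iπ/2)(1 − (−1)^{l_i} ν))})`. -/
noncomputable def pPM (ν : ℝ) (ε : ℂ) {n : ℕ} : (Fin n → ℂ) → (Fin n → Fin 2) → ℂ :=
  fun θ l => (∑ i, Complex.exp (-ε * θ i)) *
    (∑ i, Complex.exp (ε * (θ i -
      (Real.pi : ℂ) * Complex.I / 2 * (1 - (-1 : ℂ) ^ (l i : ℕ) * (ν : ℂ)))))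

open Polynomial in
/-- The numerator of the factor by which the weight of `J` is multiplied when a new particle
with exponentiated rapidity `X` is added outside of `J`. -/
noncomputable def outerNumerator {ι : Type*} [DecidableEq ι] (c : ℂ) (x : ι → ℂ)
    (S J : Finset ι) : ℂ[X] :=
  ∏ k ∈ S, (X ^ 2 + C (if k ∈ J then -(c * x k) else 0) * X + C (-(x k ^ 2)))

open Polynomial in
/-- The numerator of the factor by which the weight of `J` is multiplied, up to sign, when a new
particle with exponentiated rapidity `X` is added to `J`. -/
noncomputable def innerNumerator {ι : Type*} [DecidableEq ι] (c : ℂ) (x : ι → ℂ)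
    (S J : Finset ι) : ℂ[X] :=
  ∏ k ∈ S, (X ^ 2 + C (if k ∈ J then 0 else c * x k) * X + C (-(x k ^ 2)))

/-- The two-particle factor in exponentiated rapidities, for a particle `i` with `l_i = 0` and
a particle `j` with `l_j = 1`. -/
noncomputable def pairFactor {ι : Type*} (c : ℂ) (x : ι → ℂ) (i j : ι) : ℂ :=
  1 - c * x i * x j / (x i ^ 2 - x j ^ 2)

/-- The weight of the configuration in which exactly the particles in `J` have `l = 1`. -/
noncomputable def weight {ι : Type*} [DecidableEq ι] (c : ℂ) (x : ι → ℂ) (S J : Finset ι) : ℂ :=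
  (-1) ^ J.card * ∏ i ∈ S \ J, ∏ j ∈ J, pairFactor c x i j

/-- The sign `(-1)^{l_k}` of particle `k`. -/
def spin {ι : Type*} [DecidableEq ι] (J : Finset ι) (k : ι) : ℂ := if k ∈ J then -1 else 1

/-- The weighted sum over configurations with an insertion `p`. -/
noncomputable def weightedSum {ι : Type*} [DecidableEq ι] (c : ℂ) (x : ι → ℂ) (S : Finset ι)
    (p : Finset ι → ℂ) : ℂ :=
  ∑ J ∈ S.powerset, weight c x S J * p J

/-- The insertion whose weighted sum vanishes by virtue of the field equation. -/
noncomputable def fieldInsertion {ι : Type*} [DecidableEq ι] (x : ι → ℂ) (S J : Finset ι) : ℂ :=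
  (∑ k ∈ S, (x k)⁻¹) * (∑ k ∈ S, spin J k * x k) + (∑ k ∈ S, x k) * (∑ k ∈ S, spin J k * (x k)⁻¹)
    - 2 * (∑ k ∈ S, x k) * (∑ k ∈ S, (x k)⁻¹) * ∑ k ∈ S, spin J k

open Polynomial in
lemma monic_monicQuadratic (b d : ℂ) : (X ^ 2 + C b * X + C d).Monic := by
  rw [Monic]
  simpa using leadingCoeff_quadratic (b := b) (c := d) one_ne_zero

open Polynomial in
lemma natDegree_monicQuadratic (b d : ℂ) : (X ^ 2 + C b * X + C d).natDegree = 2 := by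
  simpa using natDegree_quadratic (b := b) (c := d) one_ne_zero

open Polynomial in
lemma natDegree_prod_quadratic {ι : Type*} (S : Finset ι) (b d : ι → ℂ) :
    (∏ k ∈ S, (X ^ 2 + C (b k) * X + C (d k))).natDegree = 2 * S.card := by
  rw [natDegree_prod_of_monic _ _ fun k _ => monic_monicQuadratic (b k) (d k)]
  simp only [natDegree_monicQuadratic, sum_const, smul_eq_mul]
  ring

open Polynomial in
lemma nextCoeff_prod_quadratic {ι : Type*} (S : Finset ι) (b d : ι → ℂ) :
    (∏ k ∈ S, (X ^ 2 + C (b k) * X + C (d k))).nextCoeff = ∑ k ∈ S, b k := by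
  rw [Monic.nextCoeff_prod _ _ fun k _ => monic_monicQuadratic (b k) (d k)]
  refine sum_congr rfl fun k _ => ?_
  rw [nextCoeff_of_natDegree_pos (by rw [natDegree_monicQuadratic]; norm_num),
    natDegree_monicQuadratic]
  simp [coeff_C]

open Polynomial in
lemma coeff_mul_quadratic {A : ℂ[X]} {m : ℕ} (hA : A.Monic) (hm : A.natDegree = 2 * m)
    (u v t : ℂ) {N : ℕ} (hN : 2 * m + 1 ≤ N) :
    (A * (C u * X ^ 2 + C v * X + C t)).coeff N
      = if N = 2 * m + 1 then v + u * A.nextCoeff else if N = 2 * m + 2 then u else 0 := by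
  have hlead : A.coeff (2 * m) = 1 := hm ▸ hA
  have hgt : ∀ k, 2 * m < k → A.coeff k = 0 := fun k hk =>
    coeff_eq_zero_of_natDegree_lt (hm ▸ hk)
  have hexp : A * (C u * X ^ 2 + C v * X + C t) = C u * (A * X ^ 2) + C v * (A * X) + C t * A := by
    ring
  obtain ⟨k, rfl⟩ : ∃ k, N = k + 1 := ⟨N - 1, by omega⟩
  rw [hexp, coeff_add, coeff_add, coeff_C_mul, coeff_C_mul, coeff_C_mul, coeff_mul_X,
    hgt (k + 1) (by omega)]
  rcases k with _ | k
  · obtain rfl : m = 0 := by omega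
    have : A.nextCoeff = 0 := by rw [nextCoeff, hm]; simp
    simp at hlead
    simp [this, hlead, coeff_mul_X_pow']
  · rw [coeff_mul_X_pow]
    by_cases h1 : k + 1 = 2 * m
    · have : A.nextCoeff = A.coeff k := by
        rw [nextCoeff_of_natDegree_pos (by omega), hm, show 2 * m - 1 = k by omega]
      rw [this, h1, hlead]
      simp
      ring
    · rw [hgt (k + 1) (by omega), if_neg (by omega)]
      by_cases h2 : k = 2 * m
      · simp [h2, hlead]
      · rw [hgt k (by omega), if_neg (by omega)]
        simp

open Polynomial in
/-- A polynomial which vanishes at zero and at `± x k` for all `k ∈ S` and has degree at most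
`2 * S.card` is zero. -/
lemma eq_zero_of_eval_eq_zero {ι : Type*} (x : ι → ℂ) {S : Finset ι} (h0 : ∀ k ∈ S, x k ≠ 0)
    (hx : ∀ i ∈ S, ∀ j ∈ S, i ≠ j → x i ^ 2 ≠ x j ^ 2) {P : ℂ[X]}
    (hdeg : ∀ N, 2 * S.card + 1 ≤ N → P.coeff N = 0) (hP0 : P.eval 0 = 0)
    (hP : ∀ k ∈ S, P.eval (x k) = 0) (hP' : ∀ k ∈ S, P.eval (-x k) = 0) : P = 0 := by
  classical
  have hinj : Set.InjOn x S := fun i hi j hj h => by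
    by_contra hij
    exact hx i hi j hj hij (by rw [h])
  have hdisj : Disjoint (S.image x) (S.image fun k => -x k) := by
    rw [disjoint_left]
    intro z hz hz'
    obtain ⟨i, hi, rfl⟩ := mem_image.1 hz
    obtain ⟨j, hj, h⟩ := mem_image.1 hz'
    by_cases hij : i = j
    · subst hij
      exact h0 i hi (self_eq_neg.1 h.symm)
    · exact hx i hi j hj hij (by rw [← h, neg_sq])
  have hzero : (0 : ℂ) ∉ S.image x ∪ S.image fun k => -x k := by
    intro h
    rcases mem_union.1 h with h | h
    · obtain ⟨i, hi, h⟩ := mem_image.1 h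
      exact h0 i hi h
    · obtain ⟨i, hi, h⟩ := mem_image.1 h
      exact h0 i hi (neg_eq_zero.1 h)
  have hcard : (insert 0 (S.image x ∪ S.image fun k => -x k)).card = 2 * S.card + 1 := by
    rw [card_insert_of_notMem hzero, card_union_of_disjoint hdisj, card_image_of_injOn hinj,
      card_image_of_injOn fun i hi j hj h => hinj hi hj (neg_injective h)]
    ring
  refine eq_zero_of_degree_lt_of_eval_finset_eq_zero
    (insert 0 (S.image x ∪ S.image fun k => -x k)) ?_ ?_
  · rw [hcard, degree_lt_iff_coeff_zero]
    exact hdeg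
  · intro z hz
    rcases mem_insert.1 hz with rfl | hz
    · exact hP0
    rcases mem_union.1 hz with hz | hz
    · obtain ⟨i, hi, rfl⟩ := mem_image.1 hz
      exact hP i hi
    · obtain ⟨i, hi, rfl⟩ := mem_image.1 hz
      exact hP' i hi

section KFunction

variable {ι : Type*} [DecidableEq ι] (c : ℂ) (x : ι → ℂ)

lemma weight_insert_of_subset {S J : Finset ι} {a : ι} (ha : a ∉ S) (hJ : J ⊆ S) :
    weight c x (insert a S) J = weight c x S J * ∏ j ∈ J, pairFactor c x a j := by
  have haJ : a ∉ J := fun h => ha (hJ h)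
  rw [weight, weight, insert_sdiff_of_notMem _ haJ, prod_insert (by simp [ha])]
  ring

lemma weight_insert_insert {S J : Finset ι} {a : ι} (ha : a ∉ S) (hJ : J ⊆ S) :
    weight c x (insert a S) (insert a J)
      = -(weight c x S J * ∏ i ∈ S \ J, pairFactor c x i a) := by
  have haJ : a ∉ J := fun h => ha (hJ h)
  have hS : insert a S \ insert a J = S \ J := by
    ext k; simp only [mem_sdiff, mem_insert]; grind
  rw [weight, weight, hS, card_insert_of_notMem haJ]
  simp only [prod_insert haJ, prod_mul_distrib]
  ring

lemma weightedSum_insert {S : Finset ι} {a : ι} (ha : a ∉ S) (p : Finset ι → ℂ) :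
    weightedSum c x (insert a S) p = ∑ J ∈ S.powerset, weight c x S J *
      ((∏ j ∈ J, pairFactor c x a j) * p J
        - (∏ i ∈ S \ J, pairFactor c x i a) * p (insert a J)) := by
  rw [weightedSum, sum_powerset_insert ha, ← sum_add_distrib]
  refine sum_congr rfl fun J hJ => ?_
  rw [mem_powerset] at hJ
  rw [weight_insert_of_subset c x ha hJ, weight_insert_insert c x ha hJ]
  ring

lemma prod_eq_prod_ite_of_subset {S J : Finset ι} (hJ : J ⊆ S) (g : ι → ℂ) :
    ∏ j ∈ J, g j = ∏ j ∈ S, if j ∈ J then g j else 1 := by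
  rw [prod_ite_mem, inter_eq_right.2 hJ]

lemma prod_sdiff_eq_prod_ite (S J : Finset ι) (g : ι → ℂ) :
    ∏ j ∈ S \ J, g j = ∏ j ∈ S, if j ∈ J then 1 else g j := by
  rw [prod_ite, prod_const_one, one_mul]
  congr 1
  ext; simp

lemma eval_outerNumerator {S J : Finset ι} {a : ι} (hJ : J ⊆ S)
    (hx : ∀ k ∈ S, x a ^ 2 ≠ x k ^ 2) :
    (outerNumerator c x S J).eval (x a)
      = (∏ k ∈ S, (x a ^ 2 - x k ^ 2)) * ∏ j ∈ J, pairFactor c x a j := by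
  rw [prod_eq_prod_ite_of_subset hJ, ← prod_mul_distrib, outerNumerator, Polynomial.eval_prod]
  refine prod_congr rfl fun k hk => ?_
  have := sub_ne_zero.2 (hx k hk)
  simp only [Polynomial.eval_add, Polynomial.eval_mul, Polynomial.eval_pow, Polynomial.eval_X,
    Polynomial.eval_C, pairFactor]
  split_ifs
  · field_simp; ring
  · ring

lemma eval_innerNumerator {S J : Finset ι} {a : ι} (hx : ∀ k ∈ S, x a ^ 2 ≠ x k ^ 2) :
    (innerNumerator c x S J).eval (x a)
      = (∏ k ∈ S, (x a ^ 2 - x k ^ 2)) * ∏ i ∈ S \ J, pairFactor c x i a := by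
  rw [prod_sdiff_eq_prod_ite, ← prod_mul_distrib, innerNumerator, Polynomial.eval_prod]
  refine prod_congr rfl fun k hk => ?_
  have := sub_ne_zero.2 (hx k hk)
  have := sub_ne_zero.2 (hx k hk).symm
  simp only [Polynomial.eval_add, Polynomial.eval_mul, Polynomial.eval_pow, Polynomial.eval_X,
    Polynomial.eval_C, pairFactor]
  split_ifs
  · ring
  · rw [← neg_sub (x a ^ 2) (x k ^ 2)] at *
    field_simp; ring

lemma eval_outerNumerator_neg {T J : Finset ι} {b : ι} (hx : ∀ k ∈ T, x b ^ 2 ≠ x k ^ 2) :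
    (∏ i ∈ T \ J, pairFactor c x i b) * (outerNumerator c x T J).eval (-x b)
      = (∏ k ∈ T, (x b ^ 2 - x k ^ 2)) * ∏ i ∈ T, pairFactor c x i b := by
  rw [prod_sdiff_eq_prod_ite, ← prod_mul_distrib, outerNumerator, Polynomial.eval_prod,
    ← prod_mul_distrib]
  refine prod_congr rfl fun k hk => ?_
  have := sub_ne_zero.2 (hx k hk)
  have := sub_ne_zero.2 (hx k hk).symm
  simp only [Polynomial.eval_add, Polynomial.eval_mul, Polynomial.eval_pow, Polynomial.eval_X,
    Polynomial.eval_C, pairFactor]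
  split_ifs
  · rw [← neg_sub (x b ^ 2) (x k ^ 2)] at *
    field_simp; ring
  · ring

lemma eval_innerNumerator_neg {T J : Finset ι} {b : ι} (hJ : J ⊆ T)
    (hx : ∀ k ∈ T, x b ^ 2 ≠ x k ^ 2) :
    (∏ j ∈ J, pairFactor c x b j) * (innerNumerator c x T J).eval (-x b)
      = (∏ k ∈ T, (x b ^ 2 - x k ^ 2)) * ∏ j ∈ T, pairFactor c x b j := by
  rw [prod_eq_prod_ite_of_subset hJ, ← prod_mul_distrib, innerNumerator, Polynomial.eval_prod,
    ← prod_mul_distrib]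
  refine prod_congr rfl fun k hk => ?_
  have := sub_ne_zero.2 (hx k hk)
  simp only [Polynomial.eval_add, Polynomial.eval_mul, Polynomial.eval_pow, Polynomial.eval_X,
    Polynomial.eval_C, pairFactor]
  split_ifs
  · ring
  · field_simp; ring

lemma eval_outerNumerator_insert_of_notMem {T J : Finset ι} {b : ι} (hb : b ∉ T) (hJ : J ⊆ T)
    {z : ℂ} (hz : z ^ 2 = x b ^ 2) : (outerNumerator c x (insert b T) J).eval z = 0 := by
  have hbJ : b ∉ J := fun h => hb (hJ h)
  rw [outerNumerator, prod_insert hb]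
  simp [hbJ, hz]

lemma eval_innerNumerator_insert_insert {T J : Finset ι} {b : ι} (hb : b ∉ T)
    {z : ℂ} (hz : z ^ 2 = x b ^ 2) :
    (innerNumerator c x (insert b T) (insert b J)).eval z = 0 := by
  rw [innerNumerator, prod_insert hb]
  simp [hz]

lemma eval_outerNumerator_insert_insert {T J : Finset ι} {b : ι} (hb : b ∉ T)
    {z : ℂ} (hz : z ^ 2 = x b ^ 2) :
    (outerNumerator c x (insert b T) (insert b J)).eval z
      = -(c * z * x b) * (outerNumerator c x T J).eval z := by
  have h : ∀ k ∈ T, (k ∈ insert b J ↔ k ∈ J) := fun k hk => by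
    simp [show k ≠ b from fun h => hb (h ▸ hk)]
  have h' : outerNumerator c x T (insert b J) = outerNumerator c x T J :=
    prod_congr rfl fun k hk => by simp only [h k hk]
  rw [← h', outerNumerator, prod_insert hb, Polynomial.eval_mul, outerNumerator]
  congr 1
  simp [hz]; ring

lemma eval_innerNumerator_insert_of_notMem {T J : Finset ι} {b : ι} (hb : b ∉ T) (hJ : J ⊆ T)
    {z : ℂ} (hz : z ^ 2 = x b ^ 2) :
    (innerNumerator c x (insert b T) J).eval z
      = c * z * x b * (innerNumerator c x T J).eval z := by
  have hbJ : b ∉ J := fun h => hb (hJ h)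
  rw [innerNumerator, prod_insert hb, Polynomial.eval_mul, innerNumerator]
  congr 1
  simp [hbJ, hz]; ring

/-- The numerator of a weighted sum as a polynomial in the exponentiated rapidity of an added
particle; `p J` and `q J` are the insertions for the particle outside of, or in, the
configuration. -/
noncomputable def sumNumerator (S : Finset ι) (p q : Finset ι → Polynomial ℂ) : Polynomial ℂ :=
  ∑ J ∈ S.powerset, Polynomial.C (weight c x S J) *
    (outerNumerator c x S J * p J - innerNumerator c x S J * q J)

lemma eval_sumNumerator {S : Finset ι} {a : ι} (ha : a ∉ S)
    (hx : ∀ k ∈ S, x a ^ 2 ≠ x k ^ 2) (p q : Finset ι → Polynomial ℂ) (r : Finset ι → ℂ) (d : ℂ)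
    (hp : ∀ J ⊆ S, (p J).eval (x a) = d * r J)
    (hq : ∀ J ⊆ S, (q J).eval (x a) = d * r (insert a J)) :
    (sumNumerator c x S p q).eval (x a)
      = d * (∏ k ∈ S, (x a ^ 2 - x k ^ 2)) * weightedSum c x (insert a S) r := by
  rw [sumNumerator, Polynomial.eval_finsetSum, weightedSum_insert c x ha, mul_sum]
  refine sum_congr rfl fun J hJ => ?_
  rw [mem_powerset] at hJ
  simp only [Polynomial.eval_sub, Polynomial.eval_mul, Polynomial.eval_C, hp J hJ, hq J hJ,
    eval_outerNumerator c x hJ hx, eval_innerNumerator c x hx]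
  ring

lemma eval_sumNumerator_insert {T : Finset ι} {b : ι} (hb : b ∉ T) {z : ℂ}
    (hz : z ^ 2 = x b ^ 2) (p q : Finset ι → Polynomial ℂ) :
    (sumNumerator c x (insert b T) p q).eval z = c * z * x b * ∑ J ∈ T.powerset, weight c x T J *
      ((∏ i ∈ T \ J, pairFactor c x i b) * (outerNumerator c x T J).eval z
          * (p (insert b J)).eval z
        - (∏ j ∈ J, pairFactor c x b j) * (innerNumerator c x T J).eval z * (q J).eval z) := by
  rw [sumNumerator, Polynomial.eval_finsetSum, sum_powerset_insert hb, ← sum_add_distrib, mul_sum]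
  refine sum_congr rfl fun J hJ => ?_
  rw [mem_powerset] at hJ
  simp only [Polynomial.eval_sub, Polynomial.eval_mul, Polynomial.eval_C,
    weight_insert_of_subset c x hb hJ, weight_insert_insert c x hb hJ,
    eval_outerNumerator_insert_of_notMem c x hb hJ hz, eval_innerNumerator_insert_insert c x hb hz,
    eval_outerNumerator_insert_insert c x hb hz, eval_innerNumerator_insert_of_notMem c x hb hJ hz]
  ring

lemma eval_sumNumerator_insert_self {T : Finset ι} {b : ι} (hb : b ∉ T)
    (hx : ∀ k ∈ T, x b ^ 2 ≠ x k ^ 2) (p q : Finset ι → Polynomial ℂ)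
    (hpq : ∀ J ⊆ T, (p (insert b J)).eval (x b) = (q J).eval (x b)) :
    (sumNumerator c x (insert b T) p q).eval (x b) = 0 := by
  rw [eval_sumNumerator_insert c x hb rfl]
  refine mul_eq_zero_of_right _ (sum_eq_zero fun J hJ => ?_)
  rw [mem_powerset] at hJ
  rw [eval_outerNumerator c x hJ hx, eval_innerNumerator c x hx, hpq J hJ]
  ring

lemma eval_sumNumerator_insert_neg {T : Finset ι} {b : ι} (hb : b ∉ T)
    (hx : ∀ k ∈ T, x b ^ 2 ≠ x k ^ 2) (p q : Finset ι → Polynomial ℂ)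
    (hpq : (∏ i ∈ T, pairFactor c x i b)
          * weightedSum c x T (fun J => (p (insert b J)).eval (-x b))
        = (∏ j ∈ T, pairFactor c x b j) * weightedSum c x T (fun J => (q J).eval (-x b))) :
    (sumNumerator c x (insert b T) p q).eval (-x b) = 0 := by
  rw [eval_sumNumerator_insert c x hb (neg_sq _)]
  refine mul_eq_zero_of_right _ ?_
  rw [← sub_eq_zero, weightedSum, weightedSum, mul_sum, mul_sum, ← sum_sub_distrib] at hpq
  rw [← mul_zero (∏ k ∈ T, (x b ^ 2 - x k ^ 2)), ← hpq, mul_sum]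
  refine sum_congr rfl fun J hJ => ?_
  rw [mem_powerset] at hJ
  rw [eval_outerNumerator_neg c x hx, eval_innerNumerator_neg c x hJ hx]
  ring

lemma spin_insert_self (J : Finset ι) (b : ι) : spin (insert b J) b = -1 := by
  simp [spin]

lemma spin_of_notMem {J : Finset ι} {b : ι} (hb : b ∉ J) : spin J b = 1 := by
  simp [spin, hb]

lemma sum_spin_insert {T : Finset ι} {b : ι} (hb : b ∉ T) (J : Finset ι) (y : ι → ℂ) :
    ∑ k ∈ T, spin (insert b J) k * y k = ∑ k ∈ T, spin J k * y k := by
  refine sum_congr rfl fun k hk => ?_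
  simp [spin, show k ≠ b from fun h => hb (h ▸ hk)]

open Polynomial in
lemma coeff_sumNumerator (S : Finset ι) (u v t u' v' t' : Finset ι → ℂ) {N : ℕ}
    (hN : 2 * S.card + 1 ≤ N) :
    (sumNumerator c x S (fun J => C (u J) * X ^ 2 + C (v J) * X + C (t J))
        (fun J => C (u' J) * X ^ 2 + C (v' J) * X + C (t' J))).coeff N
      = if N = 2 * S.card + 1 then
          weightedSum c x S (fun J => v J - v' J - c * (u J * (∑ k ∈ S, if k ∈ J then x k else 0)
            + u' J * ∑ k ∈ S, if k ∈ J then 0 else x k))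
        else if N = 2 * S.card + 2 then weightedSum c x S (fun J => u J - u' J) else 0 := by
  have h : ∀ J, (outerNumerator c x S J).nextCoeff = - c * ∑ k ∈ S, if k ∈ J then x k else 0 := by
    intro J
    rw [outerNumerator, nextCoeff_prod_quadratic, mul_sum]
    exact sum_congr rfl fun k _ => by split_ifs <;> ring
  have h' : ∀ J, (innerNumerator c x S J).nextCoeff = c * ∑ k ∈ S, if k ∈ J then 0 else x k := by
    intro J
    rw [innerNumerator, nextCoeff_prod_quadratic, mul_sum]
    exact sum_congr rfl fun k _ => by split_ifs <;> ring
  have hm : ∀ J, (outerNumerator c x S J).Monic := fun J =>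
    monic_prod_of_monic _ _ fun k _ => monic_monicQuadratic _ _
  have hm' : ∀ J, (innerNumerator c x S J).Monic := fun J =>
    monic_prod_of_monic _ _ fun k _ => monic_monicQuadratic _ _
  simp only [sumNumerator, finsetSum_coeff, coeff_C_mul, coeff_sub,
    coeff_mul_quadratic (hm _) (natDegree_prod_quadratic S _ _) _ _ _ hN,
    coeff_mul_quadratic (hm' _) (natDegree_prod_quadratic S _ _) _ _ _ hN, h, h']
  split_ifs
  · exact sum_congr rfl fun J _ => by ring
  · rfl
  · simp

lemma eval_zero_sumNumerator (S : Finset ι) (p q : Finset ι → Polynomial ℂ) :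
    (sumNumerator c x S p q).eval 0 = (∏ k ∈ S, -(x k ^ 2))
      * weightedSum c x S (fun J => (p J).eval 0 - (q J).eval 0) := by
  rw [sumNumerator, Polynomial.eval_finsetSum, weightedSum, mul_sum]
  refine sum_congr rfl fun J _ => ?_
  simp [outerNumerator, innerNumerator, Polynomial.eval_prod]
  ring

lemma weightedSum_const (S : Finset ι) (α : ℂ) :
    weightedSum c x S (fun _ => α) = α * weightedSum c x S fun _ => 1 := by
  simp only [weightedSum, mul_sum]
  exact sum_congr rfl fun J _ => by ring

/-- The K-function with constant insertion vanishes. -/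
lemma weightedSum_one_eq_zero (S : Finset ι) (hS : S.Nonempty) (h0 : ∀ k ∈ S, x k ≠ 0)
    (hx : ∀ i ∈ S, ∀ j ∈ S, i ≠ j → x i ^ 2 ≠ x j ^ 2) :
    weightedSum c x S (fun _ => 1) = 0 := by
  induction S using Finset.strongInduction with
  | H S ih =>
  obtain ⟨a, haS⟩ := hS
  obtain ⟨S, ha, rfl⟩ : ∃ T, a ∉ T ∧ S = insert a T :=
    ⟨S.erase a, notMem_erase a S, (insert_erase haS).symm⟩
  have hP : sumNumerator c x S
      (fun _ => Polynomial.C 0 * Polynomial.X ^ 2 + Polynomial.C 1 * Polynomial.X + Polynomial.C 0)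
      (fun _ => Polynomial.C 0 * Polynomial.X ^ 2 + Polynomial.C 1 * Polynomial.X + Polynomial.C 0)
      = 0 := by
    refine eq_zero_of_eval_eq_zero x (fun k hk => h0 k (mem_insert_of_mem hk))
      (fun i hi j hj => hx i (mem_insert_of_mem hi) j (mem_insert_of_mem hj)) ?_ ?_ ?_ ?_
    · intro N hN
      rw [coeff_sumNumerator c x S (fun _ => 0) (fun _ => 1) (fun _ => 0) (fun _ => 0) (fun _ => 1)
        (fun _ => 0) hN]
      simp [weightedSum]
    · rw [eval_zero_sumNumerator]
      simp [weightedSum]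
    all_goals
      intro b hbS
      obtain ⟨T, hb, rfl⟩ : ∃ T, b ∉ T ∧ S = insert b T :=
        ⟨S.erase b, notMem_erase b S, (insert_erase hbS).symm⟩
      have hxb : ∀ k ∈ T, x b ^ 2 ≠ x k ^ 2 := fun k hk =>
        hx b (by simp) k (by simp [hk]) fun h => hb (h ▸ hk)
    · exact eval_sumNumerator_insert_self c x hb hxb _ _ fun J _ => rfl
    · refine eval_sumNumerator_insert_neg c x hb hxb _ _ ?_
      rcases T.eq_empty_or_nonempty with rfl | hT
      · simp
      · have hK := ih T ((ssubset_insert hb).trans (ssubset_insert ha)) hT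
          (fun k hk => h0 k (by simp [hk]))
          (fun i hi j hj => hx i (by simp [hi]) j (by simp [hj]))
        have : weightedSum c x T (fun _ => -x b) = 0 := by
          rw [weightedSum_const, hK, mul_zero]
        simp [this]
  have hxa : ∀ k ∈ S, x a ^ 2 ≠ x k ^ 2 := fun k hk =>
    hx a (by simp) k (by simp [hk]) fun h => ha (h ▸ hk)
  have h := eval_sumNumerator c x ha hxa _ _ (fun _ => 1) (x a) (fun J _ => by simp)
    (fun J _ => by simp) |>.symm.trans (congrArg (Polynomial.eval (x a)) hP)
  rw [Polynomial.eval_zero] at h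
  refine (mul_eq_zero.1 h).resolve_left (mul_ne_zero (h0 a (by simp)) ?_)
  exact prod_ne_zero_iff.2 fun k hk => sub_ne_zero.2 (hxa k hk)

lemma sum_mul_weightedSum_one (S : Finset ι) (h0 : ∀ k ∈ S, x k ≠ 0)
    (hx : ∀ i ∈ S, ∀ j ∈ S, i ≠ j → x i ^ 2 ≠ x j ^ 2) (y : ι → ℂ) :
    (∑ k ∈ S, y k) * weightedSum c x S (fun _ => 1) = 0 := by
  rcases S.eq_empty_or_nonempty with rfl | hS
  · simp
  · rw [weightedSum_one_eq_zero c x S hS h0 hx, mul_zero]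

lemma weightedSum_linear (S : Finset ι) (α β : ℂ) (p q : Finset ι → ℂ) :
    weightedSum c x S (fun J => α * p J + β * q J)
      = α * weightedSum c x S p + β * weightedSum c x S q := by
  simp only [weightedSum, mul_sum, ← sum_add_distrib]
  exact sum_congr rfl fun J _ => by ring

open Polynomial in
/-- The polynomial `X * fieldInsertion` in the exponentiated rapidity of an added particle with
sign `ε`. -/
noncomputable def fieldPolynomial (ε : ℂ) (S J : Finset ι) : ℂ[X] :=
  C (∑ k ∈ S, spin J k * (x k)⁻¹ - 2 * (∑ k ∈ S, (x k)⁻¹) * (∑ k ∈ S, spin J k)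
      - ε * ∑ k ∈ S, (x k)⁻¹) * X ^ 2
    + C ((∑ k ∈ S, (x k)⁻¹) * (∑ k ∈ S, spin J k * x k)
      + (∑ k ∈ S, x k) * (∑ k ∈ S, spin J k * (x k)⁻¹)
      - 2 * ((∑ k ∈ S, x k) * (∑ k ∈ S, (x k)⁻¹) + 1) * (∑ k ∈ S, spin J k)
      - ε * (2 * (∑ k ∈ S, x k) * ∑ k ∈ S, (x k)⁻¹)) * X
    + C (∑ k ∈ S, spin J k * x k - 2 * (∑ k ∈ S, x k) * (∑ k ∈ S, spin J k)
      - ε * ∑ k ∈ S, x k)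

lemma sum_spin_mul_eq (S J : Finset ι) (y : ι → ℂ) :
    ∑ k ∈ S, spin J k * y k
      = (∑ k ∈ S, if k ∈ J then 0 else y k) - ∑ k ∈ S, if k ∈ J then y k else 0 := by
  rw [← sum_sub_distrib]
  exact sum_congr rfl fun k _ => by simp only [spin]; split_ifs <;> ring

lemma sum_eq_sum_ite_add (S J : Finset ι) (y : ι → ℂ) :
    ∑ k ∈ S, y k = (∑ k ∈ S, if k ∈ J then 0 else y k) + ∑ k ∈ S, if k ∈ J then y k else 0 := by
  rw [← sum_add_distrib]
  exact sum_congr rfl fun k _ => by split_ifs <;> ring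

/-- The field equation in exponentiated rapidities. -/
lemma weightedSum_fieldInsertion_eq_zero (S : Finset ι) (h0 : ∀ k ∈ S, x k ≠ 0)
    (hx : ∀ i ∈ S, ∀ j ∈ S, i ≠ j → x i ^ 2 ≠ x j ^ 2) :
    weightedSum c x S (fieldInsertion x S) = 0 := by
  induction S using Finset.strongInduction with
  | H S ih =>
  rcases S.eq_empty_or_nonempty with rfl | ⟨a, haS⟩
  · simp [weightedSum, fieldInsertion]
  obtain ⟨S, ha, rfl⟩ : ∃ T, a ∉ T ∧ S = insert a T :=
    ⟨S.erase a, notMem_erase a S, (insert_erase haS).symm⟩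
  have hS0 : ∀ k ∈ S, x k ≠ 0 := fun k hk => h0 k (mem_insert_of_mem hk)
  have hSx : ∀ i ∈ S, ∀ j ∈ S, i ≠ j → x i ^ 2 ≠ x j ^ 2 := fun i hi j hj =>
    hx i (mem_insert_of_mem hi) j (mem_insert_of_mem hj)
  have hP : sumNumerator c x S (fieldPolynomial x 1 S) (fieldPolynomial x (-1) S) = 0 := by
    refine eq_zero_of_eval_eq_zero x hS0 hSx ?_ ?_ ?_ ?_
    · intro N hN
      unfold fieldPolynomial
      rw [coeff_sumNumerator c x S _ _ _ _ _ _ hN]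
      split_ifs
      · have h1 := sum_mul_weightedSum_one c x S hS0 hSx x
        have h2 := ih S (ssubset_insert ha) hS0 hSx
        have h3 := weightedSum_linear c x S (-4 * (∑ k ∈ S, x k) * ∑ k ∈ S, (x k)⁻¹) (-c)
          (fun _ => 1) (fieldInsertion x S)
        rw [h2] at h3
        refine Eq.trans ?_ (h3.trans (by linear_combination -4 * (∑ k ∈ S, (x k)⁻¹) * h1))
        refine congrArg _ (funext fun J => ?_)
        rw [fieldInsertion, sum_spin_mul_eq S J x, sum_eq_sum_ite_add S J x]
        ring
      · have h1 := sum_mul_weightedSum_one c x S hS0 hSx fun k => (x k)⁻¹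
        refine Eq.trans ?_ ((weightedSum_const c x S (-2 * ∑ k ∈ S, (x k)⁻¹)).trans
          (by linear_combination -2 * h1))
        exact congrArg _ (funext fun J => by ring)
      · rfl
    · rw [eval_zero_sumNumerator]
      refine mul_eq_zero_of_right _ ?_
      have h1 := sum_mul_weightedSum_one c x S hS0 hSx x
      refine Eq.trans ?_ ((weightedSum_const c x S (-2 * ∑ k ∈ S, x k)).trans
        (by linear_combination -2 * h1))
      refine congrArg _ (funext fun J => ?_)
      simp only [fieldPolynomial, Polynomial.eval_add, Polynomial.eval_mul, Polynomial.eval_pow,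
        Polynomial.eval_X, Polynomial.eval_C]
      ring
    all_goals
      intro b hbS
      obtain ⟨T, hb, rfl⟩ : ∃ T, b ∉ T ∧ S = insert b T :=
        ⟨S.erase b, notMem_erase b S, (insert_erase hbS).symm⟩
      have hxb : ∀ k ∈ T, x b ^ 2 ≠ x k ^ 2 := fun k hk =>
        hSx b (by simp) k (by simp [hk]) fun h => hb (h ▸ hk)
      have hb0 := hS0 b (by simp)
      have hT : ∀ J, ∑ k ∈ T, spin (insert b J) k = ∑ k ∈ T, spin J k := fun J => by
        simpa using sum_spin_insert hb J fun _ => 1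
    · refine eval_sumNumerator_insert_self c x hb hxb _ _ fun J hJ => ?_
      simp only [fieldPolynomial, Polynomial.eval_add, Polynomial.eval_mul, Polynomial.eval_pow,
        Polynomial.eval_X, Polynomial.eval_C, sum_insert hb, spin_insert_self,
        spin_of_notMem fun h => hb (hJ h), sum_spin_insert hb, hT]
      field_simp
      ring
    · have hT0 : ∀ k ∈ T, x k ≠ 0 := fun k hk => hS0 k (mem_insert_of_mem hk)
      have hTx : ∀ i ∈ T, ∀ j ∈ T, i ≠ j → x i ^ 2 ≠ x j ^ 2 := fun i hi j hj =>
        hSx i (mem_insert_of_mem hi) j (mem_insert_of_mem hj)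
      have hF := ih T ((ssubset_insert hb).trans (ssubset_insert ha)) hT0 hTx
      have hE := sum_mul_weightedSum_one c x T hT0 hTx x
      have hE' := sum_mul_weightedSum_one c x T hT0 hTx fun k => (x k)⁻¹
      have hzero : ∀ ε : ℂ, weightedSum c x T (fun J => -x b * fieldInsertion x T J
          + ε * (2 * x b ^ 2 * (∑ k ∈ T, (x k)⁻¹) + 2 * ∑ k ∈ T, x k) * 1) = 0 := fun ε => by
        rw [weightedSum_linear, hF]
        linear_combination 2 * ε * x b ^ 2 * hE' + 2 * ε * hE
      have hp : weightedSum c x T (fun J =>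
          (fieldPolynomial x 1 (insert b T) (insert b J)).eval (-x b)) = 0 := by
        rw [← hzero 1, weightedSum, weightedSum]
        refine sum_congr rfl fun J hJ => ?_
        simp only [fieldPolynomial, fieldInsertion, Polynomial.eval_add, Polynomial.eval_mul,
          Polynomial.eval_pow, Polynomial.eval_X, Polynomial.eval_C, sum_insert hb,
          spin_insert_self, sum_spin_insert hb, hT]
        field_simp
        ring
      have hq : weightedSum c x T (fun J =>
          (fieldPolynomial x (-1) (insert b T) J).eval (-x b)) = 0 := by
        rw [← hzero (-1), weightedSum, weightedSum]
        refine sum_congr rfl fun J hJ => ?_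
        rw [mem_powerset] at hJ
        simp only [fieldPolynomial, fieldInsertion, Polynomial.eval_add, Polynomial.eval_mul,
          Polynomial.eval_pow, Polynomial.eval_X, Polynomial.eval_C, sum_insert hb,
          spin_of_notMem fun h => hb (hJ h)]
        field_simp
        ring
      exact eval_sumNumerator_insert_neg c x hb hxb _ _ (by rw [hp, hq, mul_zero, mul_zero])
  have hxa : ∀ k ∈ S, x a ^ 2 ≠ x k ^ 2 := fun k hk =>
    hx a (by simp) k (by simp [hk]) fun h => ha (h ▸ hk)
  have ha0 := h0 a (by simp)
  have hT : ∀ J, ∑ k ∈ S, spin (insert a J) k = ∑ k ∈ S, spin J k := fun J => by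
    simpa using sum_spin_insert ha J fun _ => 1
  have h := eval_sumNumerator c x ha hxa (fieldPolynomial x 1 S) (fieldPolynomial x (-1) S)
    (fieldInsertion x (insert a S)) (x a)
    (fun J hJ => by
      simp only [fieldPolynomial, fieldInsertion, Polynomial.eval_add, Polynomial.eval_mul,
        Polynomial.eval_pow, Polynomial.eval_X, Polynomial.eval_C, sum_insert ha,
        spin_of_notMem fun h => ha (hJ h)]
      field_simp
      ring)
    (fun J hJ => by
      simp only [fieldPolynomial, fieldInsertion, Polynomial.eval_add, Polynomial.eval_mul,
        Polynomial.eval_pow, Polynomial.eval_X, Polynomial.eval_C, sum_insert ha,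
        spin_insert_self, sum_spin_insert ha, hT]
      field_simp
      ring) |>.symm.trans (congrArg (Polynomial.eval (x a)) hP)
  rw [Polynomial.eval_zero] at h
  refine (mul_eq_zero.1 h).resolve_left (mul_ne_zero ha0 ?_)
  exact prod_ne_zero_iff.2 fun k hk => sub_ne_zero.2 (hxa k hk)

end KFunction

lemma prod_prod_eq_prod_prod_lt {n : ℕ} (g : Fin n → Fin n → ℂ) (hg : ∀ i, g i i = 1) :
    ∏ i, ∏ j, g i j = ∏ i : Fin n, ∏ j : Fin n, if (i : ℕ) < (j : ℕ) then g i j * g j i else 1 := by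
  have h : ∀ i j, g i j = (if (i : ℕ) < (j : ℕ) then g i j else 1)
      * (if (j : ℕ) < (i : ℕ) then g i j else 1) := fun i j => by
    rcases lt_trichotomy (i : ℕ) (j : ℕ) with h | h | h
    · rw [if_pos h, if_neg h.not_gt, mul_one]
    · rw [if_neg h.not_lt, if_neg h.not_gt, Fin.ext h, hg, one_mul]
    · rw [if_pos h, if_neg h.not_gt, one_mul]
  have h' : ∀ i j : Fin n, (if (i : ℕ) < (j : ℕ) then g i j else 1)
      * (if (i : ℕ) < (j : ℕ) then g j i else 1)
      = if (i : ℕ) < (j : ℕ) then g i j * g j i else 1 := fun i j => by split_ifs <;> simp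
  rw [prod_congr rfl fun i _ => prod_congr rfl fun j _ => h i j]
  rw [← prod_congr rfl fun i _ => prod_congr rfl fun j _ => h' i j]
  simp only [prod_mul_distrib]
  congr 1
  exact prod_comm

lemma exp_sq_sub_exp_sq (a b : ℂ) :
    Complex.exp a ^ 2 - Complex.exp b ^ 2
      = 2 * Complex.exp a * Complex.exp b * Complex.sinh (a - b) := by
  have ha := Complex.exp_ne_zero a
  have hb := Complex.exp_ne_zero b
  rw [Complex.sinh, neg_sub, Complex.exp_sub, Complex.exp_sub]
  field_simp

lemma pairFactor_exp {n : ℕ} (s : ℂ) (θ : Fin n → ℂ) {i j : Fin n}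
    (h : Complex.sinh (θ i - θ j) ≠ 0) :
    pairFactor (2 * Complex.I * s) (fun k => Complex.exp (θ k)) i j
      = 1 - Complex.I * s / Complex.sinh (θ i - θ j) := by
  have hi := Complex.exp_ne_zero (θ i)
  have hj := Complex.exp_ne_zero (θ j)
  rw [pairFactor, exp_sq_sub_exp_sq]
  field_simp

lemma Admissible.sinh_sub_ne_zero {n : ℕ} {θ : Fin n → ℂ} (hθ : Admissible θ) {i j : Fin n}
    (hij : i ≠ j) : Complex.sinh (θ i - θ j) ≠ 0 := by
  rcases lt_or_gt_of_ne hij with h | h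
  · exact hθ i j h
  · rw [← neg_sub, Complex.sinh_neg]
    exact neg_ne_zero.2 (hθ j i h)

lemma Kfun_eq_weightedSum (ν : ℝ) {n : ℕ} (p : (Fin n → ℂ) → (Fin n → Fin 2) → ℂ)
    {θ : Fin n → ℂ} (hθ : Admissible θ) :
    Kfun ν p θ = weightedSum (2 * Complex.I * (Real.sin (Real.pi * ν) : ℂ))
      (fun k => Complex.exp (θ k)) univ (fun J => p θ fun i => if i ∈ J then 1 else 0) := by
  rw [Kfun, weightedSum, powerset_univ]
  symm
  refine sum_nbij' (fun J i => if i ∈ J then 1 else 0) (fun l => univ.filter fun i => l i = 1)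
    (by simp) (by simp) (fun J _ => by ext; simp) (fun l _ => ?_) (fun J _ => ?_)
  · funext i
    by_cases h : l i = 1
    · simp [h]
    · simpa [h] using (by omega : 0 = l i)
  have hcard : ∑ i : Fin n, (((if i ∈ J then 1 else 0 : Fin 2) : ℕ)) = J.card := by
    rw [card_eq_sum_ones, ← sum_filter_add_sum_filter_not univ (· ∈ J)]
    simp +contextual
  rw [weight, hcard]
  congr 2
  have h1 : ∏ i ∈ univ \ J, ∏ j ∈ J, pairFactor (2 * Complex.I * (Real.sin (Real.pi * ν) : ℂ))
        (fun k => Complex.exp (θ k)) i j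
      = ∏ i, ∏ j, if i ∉ J ∧ j ∈ J then
          pairFactor (2 * Complex.I * (Real.sin (Real.pi * ν) : ℂ))
            (fun k => Complex.exp (θ k)) i j else 1 := by
    rw [prod_sdiff_eq_prod_ite]
    refine prod_congr rfl fun i _ => ?_
    by_cases hi : i ∈ J
    · simp [hi]
    · simp [hi, prod_ite_mem]
  rw [h1, prod_prod_eq_prod_prod_lt _ fun i => by simp]
  refine prod_congr rfl fun i _ => prod_congr rfl fun j _ => ?_
  by_cases hij : (i : ℕ) < (j : ℕ)
  · have hne : i ≠ j := Fin.ne_of_lt hij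
    rw [if_pos hij, if_pos hij, pairFactor_exp _ θ (hθ.sinh_sub_ne_zero hne),
      pairFactor_exp _ θ (hθ.sinh_sub_ne_zero hne.symm), ← neg_sub (θ i) (θ j), Complex.sinh_neg]
    by_cases hi : i ∈ J <;> by_cases hj : j ∈ J <;> simp [hi, hj] <;> ring
  · rw [if_neg hij, if_neg hij]

lemma exp_shift (ν : ℝ) (t ε σ : ℂ) (hε : ε = 1 ∨ ε = -1) (hσ : σ = 1 ∨ σ = -1) :
    Complex.exp (ε * (t - (Real.pi : ℂ) * Complex.I / 2 * (1 - σ * (ν : ℂ))))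
      = Complex.exp (ε * t) * (σ * Complex.sin (Real.pi * ν / 2)
        - ε * Complex.I * Complex.cos (Real.pi * ν / 2)) := by
  have h : ε * (t - (Real.pi : ℂ) * Complex.I / 2 * (1 - σ * (ν : ℂ)))
      = ε * t + (-ε * (Real.pi / 2 * Complex.I) + ε * σ * (Real.pi * ν / 2) * Complex.I) := by
    ring
  rw [h, Complex.exp_add, Complex.exp_add]
  congr 1
  have e1 : Complex.exp (-ε * (Real.pi / 2 * Complex.I)) = -ε * Complex.I := by
    rcases hε with rfl | rfl
    · rw [neg_one_mul, Complex.exp_neg, Complex.exp_pi_div_two_mul_I, Complex.inv_I, neg_one_mul]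
    · rw [neg_neg, one_mul, Complex.exp_pi_div_two_mul_I, one_mul]
  have e2 : Complex.exp (ε * σ * (Real.pi * ν / 2) * Complex.I)
      = Complex.cos (Real.pi * ν / 2) + ε * σ * Complex.sin (Real.pi * ν / 2) * Complex.I := by
    rw [Complex.exp_mul_I]
    rcases hε with rfl | rfl <;> rcases hσ with rfl | rfl <;> simp
  have hε2 : ε ^ 2 = 1 := by rcases hε with rfl | rfl <;> norm_num
  rw [e1, e2]
  linear_combination -ε ^ 2 * σ * Complex.sin (Real.pi * ν / 2) * Complex.I_sq
    + σ * Complex.sin (Real.pi * ν / 2) * hε2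

lemma Kfun_pPM (ν : ℝ) (ε : ℂ) (hε : ε = 1 ∨ ε = -1) {n : ℕ} {θ : Fin n → ℂ}
    (hθ : Admissible θ)
    (hone : weightedSum (2 * Complex.I * (Real.sin (Real.pi * ν) : ℂ))
      (fun k => Complex.exp (θ k)) univ (fun _ => 1) = 0) :
    Kfun ν (pPM ν ε) θ = Complex.sin (Real.pi * ν / 2) * ((∑ i, Complex.exp (-ε * θ i))
      * weightedSum (2 * Complex.I * (Real.sin (Real.pi * ν) : ℂ)) (fun k => Complex.exp (θ k))
        univ (fun J => ∑ k, spin J k * Complex.exp (ε * θ k))) := by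
  rw [Kfun_eq_weightedSum ν _ hθ]
  have h := weightedSum_linear (2 * Complex.I * (Real.sin (Real.pi * ν) : ℂ))
    (fun k => Complex.exp (θ k)) univ
    (Complex.sin (Real.pi * ν / 2) * ∑ i, Complex.exp (-ε * θ i))
    (-(ε * Complex.I * Complex.cos (Real.pi * ν / 2) * (∑ i, Complex.exp (-ε * θ i))
      * ∑ i, Complex.exp (ε * θ i)))
    (fun J => ∑ k, spin J k * Complex.exp (ε * θ k)) (fun _ => 1)
  rw [hone, mul_zero, add_zero] at h
  rw [← mul_assoc, ← h]
  refine congrArg _ (funext fun J => ?_)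
  have hspin : ∀ k, (-1 : ℂ) ^ ((if k ∈ J then 1 else 0 : Fin 2) : ℕ) = spin J k := fun k => by
    rw [spin]; split_ifs <;> simp
  have hsum : ∑ i, Complex.exp (ε * (θ i - (Real.pi : ℂ) * Complex.I / 2
        * (1 - spin J i * (ν : ℂ))))
      = Complex.sin (Real.pi * ν / 2) * (∑ k, spin J k * Complex.exp (ε * θ k))
        - ε * Complex.I * Complex.cos (Real.pi * ν / 2) * ∑ k, Complex.exp (ε * θ k) := by
    rw [mul_sum, mul_sum, ← sum_sub_distrib]
    refine sum_congr rfl fun k _ => ?_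
    rw [exp_shift ν (θ k) ε (spin J k) hε (by rw [spin]; split_ifs <;> simp)]
    ring
  simp only [pPM, hspin, hsum]
  ring

/-- quantum sine-Gordon field equation at the level of K-functions,
Theorem 4.1: with `K_n^{(1)} = N_n^{(1)} K̃_n^{(1)}`, `N_n^{(1)} = ((1/2)√Z)^n (πν/β)^{1−n}`,
`K_n^{±} = N_n^{±} K̃_n^{±}`, `N_n^{±} = ±i (sin(πν)/sin(πν/2)) (√Z β/(2πν))^n`, one has
`(Σ e^{θ_i})(Σ e^{−θ_i}) K_n^{(1)}(θ) = (πν/(β sin πν)) (1/(2i)) (K_n^{+}(θ) − K_n^{−}(θ))`. -/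
theorem quantum_field_equation (ν β Z : ℝ) (hν0 : 0 < ν) (hν1 : ν < 1)
    (hβ : 0 < β) (hZ : 0 < Z) (n : ℕ) (hn : 1 ≤ n)
    (θ : Fin n → ℂ) (hθ : Admissible θ) :
    (∑ i, Complex.exp (θ i)) * (∑ i, Complex.exp (-θ i)) *
      ((((1 / 2 : ℝ) * Real.sqrt Z : ℝ) : ℂ) ^ n *
        ((Real.pi * ν / β : ℝ) : ℂ) ^ ((1 : ℤ) - (n : ℤ)) * Kfun ν (pN 1) θ)
    = ((Real.pi * ν / (β * Real.sin (Real.pi * ν)) : ℝ) : ℂ) * (1 / (2 * Complex.I)) *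
      ((Complex.I * ((Real.sin (Real.pi * ν) / Real.sin (Real.pi * ν / 2) : ℝ) : ℂ) *
          ((Real.sqrt Z * β / (2 * Real.pi * ν) : ℝ) : ℂ) ^ n * Kfun ν (pPM ν 1) θ)
       - (-Complex.I * ((Real.sin (Real.pi * ν) / Real.sin (Real.pi * ν / 2) : ℝ) : ℂ) *
          ((Real.sqrt Z * β / (2 * Real.pi * ν) : ℝ) : ℂ) ^ n * Kfun ν (pPM ν (-1)) θ)) := by
  have hx0 : ∀ k ∈ (univ : Finset (Fin n)), Complex.exp (θ k) ≠ 0 := fun k _ =>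
    Complex.exp_ne_zero _
  have hx : ∀ i ∈ (univ : Finset (Fin n)), ∀ j ∈ (univ : Finset (Fin n)), i ≠ j →
      Complex.exp (θ i) ^ 2 ≠ Complex.exp (θ j) ^ 2 := fun i _ j _ hij => by
    rw [← sub_ne_zero, exp_sq_sub_exp_sq]
    have := hθ.sinh_sub_ne_zero hij
    simp [this]
  have hone := weightedSum_one_eq_zero (2 * Complex.I * (Real.sin (Real.pi * ν) : ℂ))
    (fun k => Complex.exp (θ k)) univ ⟨⟨0, hn⟩, mem_univ _⟩ hx0 hx
  have hfield := weightedSum_fieldInsertion_eq_zero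
    (2 * Complex.I * (Real.sin (Real.pi * ν) : ℂ)) (fun k => Complex.exp (θ k)) univ hx0 hx
  have hN : Kfun ν (pN 1) θ = weightedSum (2 * Complex.I * (Real.sin (Real.pi * ν) : ℂ))
      (fun k => Complex.exp (θ k)) univ (fun J => ∑ k, spin J k) := by
    rw [Kfun_eq_weightedSum ν _ hθ]
    refine congrArg _ (funext fun J => ?_)
    rw [pN, pow_one]
    exact sum_congr rfl fun k _ => by rw [spin]; split_ifs <;> simp
  have hexpand : weightedSum (2 * Complex.I * (Real.sin (Real.pi * ν) : ℂ))
      (fun k => Complex.exp (θ k)) univ (fieldInsertion (fun k => Complex.exp (θ k)) univ)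
      = (∑ k, Complex.exp (-θ k)) * weightedSum (2 * Complex.I * (Real.sin (Real.pi * ν) : ℂ))
          (fun k => Complex.exp (θ k)) univ (fun J => ∑ k, spin J k * Complex.exp (θ k))
        + (∑ k, Complex.exp (θ k)) * weightedSum (2 * Complex.I * (Real.sin (Real.pi * ν) : ℂ))
          (fun k => Complex.exp (θ k)) univ (fun J => ∑ k, spin J k * Complex.exp (-θ k))
        - 2 * (∑ k, Complex.exp (θ k)) * (∑ k, Complex.exp (-θ k)) * Kfun ν (pN 1) θ := by
    rw [hN]
    simp only [weightedSum, fieldInsertion, ← Complex.exp_neg]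
    generalize ∑ k, Complex.exp (θ k) = E
    generalize ∑ k, Complex.exp (-θ k) = E'
    rw [mul_sum, mul_sum, mul_sum, ← sum_add_distrib, ← sum_sub_distrib]
    exact sum_congr rfl fun J _ => by ring
  rw [hfield] at hexpand
  rw [Kfun_pPM ν 1 (Or.inl rfl) hθ hone, Kfun_pPM ν (-1) (Or.inr rfl) hθ hone]
  simp only [neg_neg, one_mul, neg_one_mul]
  have hpiν : 0 < Real.pi * ν := mul_pos Real.pi_pos hν0
  have hs : Real.sin (Real.pi * ν) ≠ 0 :=
    (Real.sin_pos_of_pos_of_lt_pi hpiν (by nlinarith [Real.pi_pos])).ne'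
  have hs2 : Real.sin (Real.pi * ν / 2) ≠ 0 :=
    (Real.sin_pos_of_pos_of_lt_pi (by linarith) (by nlinarith [Real.pi_pos])).ne'
  have hsin : Complex.sin (Real.pi * ν / 2) = (Real.sin (Real.pi * ν / 2) : ℂ) := by
    push_cast; rfl
  rw [hsin]
  have hc1 : ((Real.pi * ν / (β * Real.sin (Real.pi * ν)) : ℝ) : ℂ)
      * ((Real.sin (Real.pi * ν) / Real.sin (Real.pi * ν / 2) : ℝ) : ℂ)
      * (Real.sin (Real.pi * ν / 2) : ℂ) = ((Real.pi * ν / β : ℝ) : ℂ) := by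
    norm_cast
    field_simp
  have hc2 : (((1 / 2 : ℝ) * Real.sqrt Z : ℝ) : ℂ) ^ n
      * ((Real.pi * ν / β : ℝ) : ℂ) ^ ((1 : ℤ) - (n : ℤ))
      = ((Real.pi * ν / β : ℝ) : ℂ) * ((Real.sqrt Z * β / (2 * Real.pi * ν) : ℝ) : ℂ) ^ n := by
    have hb : ((Real.pi * ν / β : ℝ) : ℂ) ≠ 0 := by exact_mod_cast (div_pos hpiν hβ).ne'
    have hq : ((Real.sqrt Z * β / (2 * Real.pi * ν) : ℝ) : ℂ)
        = (((1 / 2 : ℝ) * Real.sqrt Z : ℝ) : ℂ) / ((Real.pi * ν / β : ℝ) : ℂ) := by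
      rw [← Complex.ofReal_div]
      congr 1
      field_simp
    rw [hq, zpow_sub₀ hb, zpow_one, zpow_natCast, div_pow]
    ring
  rw [hc2, ← hc1]
  generalize ((Real.pi * ν / (β * Real.sin (Real.pi * ν)) : ℝ) : ℂ) = A at *
  generalize ((Real.sin (Real.pi * ν) / Real.sin (Real.pi * ν / 2) : ℝ) : ℂ) = B at *
  generalize (Real.sin (Real.pi * ν / 2) : ℂ) = s at *
  generalize ((Real.sqrt Z * β / (2 * Real.pi * ν) : ℝ) : ℂ) ^ n = D at *
  have hI : (1 / (2 * Complex.I)) * Complex.I = 1 / 2 := by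
    field_simp
  linear_combination A * B * s * D * (1 / 2) * hexpand - A * B * s * D
    * ((∑ k, Complex.exp (-θ k)) * weightedSum (2 * Complex.I * (Real.sin (Real.pi * ν) : ℂ))
          (fun k => Complex.exp (θ k)) univ (fun J => ∑ k, spin J k * Complex.exp (θ k))
        + (∑ k, Complex.exp (θ k)) * weightedSum (2 * Complex.I * (Real.sin (Real.pi * ν) : ℂ))
          (fun k => Complex.exp (θ k)) univ (fun J => ∑ k, spin J k * Complex.exp (-θ k))) * hI
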